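/- arXiv:1508.07770 — 3 statements merged into one kernel-verified Lean document; each statement's English description precedes it below -/
import Mathlib

section
/- Normalization of the bivariate quantum q-Krawtchouk weight: for every real q with 0 < q < 1, every positive integer N and all nonzero real numbers θ, φ, the weight function Δ^{(N)}_{x₁,x₂}(θ,φ) sums to one over the discrete simplex: Σ_{x₁,x₂ ≥ 0, x₁+x₂ ≤ N} Δ^{(N)}_{x₁,x₂}(θ,φ) = 1. -/
open Finset

/-- The q-Pochhammer symbol `(a;q)_n = ∏_{k=0}^{n-1} (1 - a q^k)`. -/
noncomputable def qPoch (q a : ℝ) (n : ℕ) : ℝ := ∏ k ∈ Finset.range n, (1 - a * q ^ k)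

/-- The quantum q-Krawtchouk polynomial `k_n(x;p,N;q)`, defined for all integers `x, N`. -/
noncomputable def qKraw (q : ℝ) (n : ℕ) (x N : ℤ) (p : ℝ) : ℝ :=
  (-1 : ℝ) ^ n * q ^ (n * (n - 1) / 2) *
    ∑ k ∈ Finset.range (n + 1),
      qPoch q (q ^ (-(n : ℤ))) k * qPoch q (q ^ (-x)) k *
        qPoch q (q ^ ((k : ℤ) - N)) (n - k) / qPoch q q k * (p * q ^ (n + 1)) ^ k

/-- The bivariate quantum q-Krawtchouk polynomial of Gasper and Rahman,
`K_{n₁,n₂}(x₁,x₂;θ,φ;N) = k_{n₁}(x₁;θ^{-2},x₁+x₂;q) k_{n₂}(x₁+x₂-n₁;φ^{-2},N-n₁;q)`,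
with the convention that it vanishes when a degree index is negative. -/
noncomputable def Kq (q : ℝ) (n₁ n₂ x₁ x₂ : ℤ) (θ φ : ℝ) (N : ℤ) : ℝ :=
  if 0 ≤ n₁ ∧ 0 ≤ n₂ then
    qKraw q n₁.toNat x₁ (x₁ + x₂) (θ ^ 2)⁻¹ *
      qKraw q n₂.toNat (x₁ + x₂ - n₁) (N - n₁) (φ ^ 2)⁻¹
  else 0

/-- The q-trinomial coefficient `[N; x₁, x₂]_q`. -/
noncomputable def qTrinom (q : ℝ) (N x₁ x₂ : ℕ) : ℝ :=
  qPoch q q N / (qPoch q q x₁ * qPoch q q x₂ * qPoch q q (N - x₁ - x₂))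

/-- The orthogonality weight `Δ^{(N)}_{x₁,x₂}(θ,φ)`. -/
noncomputable def Δw (q : ℝ) (N x₁ x₂ : ℕ) (θ φ : ℝ) : ℝ :=
  (-1 : ℝ) ^ (N - x₁) * (θ ^ 2 * q⁻¹) ^ (x₁ + x₂) * q ^ (x₁ * (x₁ - 1) / 2) *
    qTrinom q N x₁ x₂ * qPoch q ((θ ^ 2)⁻¹ * q) x₂ * qPoch q ((φ ^ 2)⁻¹ * q) (N - x₁ - x₂) *
    φ ^ (2 * N) * q ^ (-((N : ℤ) * (N + 1) / 2))

/-- The normalization constant `H^{(N)}_{n₁,n₂}(θ,φ)`. -/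
noncomputable def Hn (q : ℝ) (N n₁ n₂ : ℕ) (θ φ : ℝ) : ℝ :=
  (-1 : ℝ) ^ (n₁ + n₂) * qPoch q (q * (θ ^ 2)⁻¹) n₁ * qPoch q (q * (φ ^ 2)⁻¹) n₂ *
    φ ^ (2 * n₁) * (qPoch q q N / qPoch q q (N - n₁ - n₂)) ^ 2 * (qTrinom q N n₁ n₂)⁻¹ *
    q ^ (3 * ((n₁ : ℤ) * (n₁ - 1)) / 2 + 3 * ((n₂ : ℤ) * (n₂ - 1)) / 2 +
          (n₁ : ℤ) * n₂ - (N : ℤ) * (n₁ + n₂) - 2 * n₁ - n₂)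

/-- The dual weight `Δ̃^{(N)}_{n₁,n₂}(θ,φ)`. -/
noncomputable def Δdual (q : ℝ) (N n₁ n₂ : ℕ) (θ φ : ℝ) : ℝ :=
  (-1 : ℝ) ^ (n₁ + n₂) * q ^ (-((n₁ : ℤ) * (n₁ - 1)) - (n₂ : ℤ) * (n₂ - 1)) *
    φ ^ (-(2 * (n₁ : ℤ))) * (qPoch q q (N - n₁ - n₂) / qPoch q q N) ^ 2 * qTrinom q N n₁ n₂ *
    q ^ ((N : ℤ) * (n₁ + n₂) + 2 * n₁ + n₂ - (n₁ : ℤ) * n₂ -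
          (n₁ : ℤ) * (n₁ - 1) / 2 - (n₂ : ℤ) * (n₂ - 1) / 2) /
    (qPoch q (q * (θ ^ 2)⁻¹) n₁ * qPoch q (q * (φ ^ 2)⁻¹) n₂)

theorem qPoch_succ (q a : ℝ) (n : ℕ) : qPoch q a (n + 1) = qPoch q a n * (1 - a * q ^ n) := by
  simp [qPoch, Finset.prod_range_succ]

theorem qPoch_succ' (q a : ℝ) (n : ℕ) :
    qPoch q a (n + 1) = (1 - a) * qPoch q (a * q) n := by
  simp only [qPoch, Finset.prod_range_succ', pow_zero, mul_one]
  rw [mul_comm]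
  congr 1
  exact Finset.prod_congr rfl fun k _ => by ring

theorem qPoch_self_ne_zero {q : ℝ} (hq0 : 0 < q) (hq1 : q < 1) (n : ℕ) : qPoch q q n ≠ 0 := by
  refine Finset.prod_ne_zero_iff.2 fun k _ => ?_
  have : q * q ^ k < 1 := by
    rw [← pow_succ']
    exact pow_lt_one₀ hq0.le hq1 (Nat.succ_ne_zero k)
  linarith

theorem succ_mul_self_div_two (n : ℕ) : (n + 1) * n / 2 = n * (n - 1) / 2 + n := by
  have h := Nat.triangle_succ n
  simpa using h

/-- A terminating `q`-Chu–Vandermonde type summation. -/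
theorem sum_antidiagonal_qPoch {q : ℝ} (hq0 : 0 < q) (hq1 : q < 1) (n : ℕ) (a : ℝ) :
    ∑ p ∈ antidiagonal n, (-1 : ℝ) ^ p.2 * q ^ (p.1 * (p.1 - 1) / 2) * qPoch q a p.2 /
      (qPoch q q p.1 * qPoch q q p.2) = a ^ n * q ^ (n * (n - 1) / 2) / qPoch q q n := by
  have hne := qPoch_self_ne_zero hq0 hq1
  induction n generalizing a with
  | zero => simp [qPoch]
  | succ n ih =>
    have hfac : ∀ m, 1 - q * q ^ m ≠ 0 := fun m h =>
      hne (m + 1) (by rw [qPoch_succ, h, mul_zero])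
    have hn := hfac n
    set F : ℕ × ℕ → ℝ := fun p => (-1 : ℝ) ^ p.2 * q ^ (p.1 * (p.1 - 1) / 2) * qPoch q a p.2 /
      (qPoch q q p.1 * qPoch q q p.2) with hF
    have split : (1 - q * q ^ n) * ∑ p ∈ antidiagonal (n + 1), F p =
        ∑ p ∈ antidiagonal (n + 1), (1 - q ^ p.2) * F p +
          ∑ p ∈ antidiagonal (n + 1), q ^ p.2 * (1 - q ^ p.1) * F p := by
      rw [Finset.mul_sum, ← Finset.sum_add_distrib]
      refine Finset.sum_congr rfl fun p hp => ?_
      rw [← pow_succ', ← mem_antidiagonal.1 hp, pow_add]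
      ring
    have h₁ : ∑ p ∈ antidiagonal (n + 1), (1 - q ^ p.2) * F p =
        -(1 - a) * ((a * q) ^ n * q ^ (n * (n - 1) / 2) / qPoch q q n) := by
      rw [Finset.Nat.sum_antidiagonal_succ', ← ih (a * q), Finset.mul_sum]
      simp only [pow_zero, sub_self, zero_mul, zero_add]
      refine Finset.sum_congr rfl fun p _ => ?_
      have := hne p.1
      have := hne p.2
      have := hfac p.2
      simp only [hF]
      rw [qPoch_succ' q a, qPoch_succ q q, pow_succ' q]
      field_simp
      ring
    have h₂ : ∑ p ∈ antidiagonal (n + 1), q ^ p.2 * (1 - q ^ p.1) * F p =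
        q ^ n * (a ^ n * q ^ (n * (n - 1) / 2) / qPoch q q n) := by
      rw [Finset.Nat.sum_antidiagonal_succ, ← ih a, Finset.mul_sum]
      simp only [pow_zero, sub_self, zero_mul, mul_zero, zero_add]
      refine Finset.sum_congr rfl fun p hp => ?_
      have := hne p.1
      have := hne p.2
      have := hfac p.1
      simp only [hF]
      rw [qPoch_succ q q p.1, ← mem_antidiagonal.1 hp, Nat.add_sub_cancel,
        succ_mul_self_div_two, pow_succ' q p.1, pow_add, pow_add]
      field_simp
    have := hne n
    refine mul_left_cancel₀ hn ?_
    rw [split, h₁, h₂, qPoch_succ, Nat.add_sub_cancel, succ_mul_self_div_two, pow_add q,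
      mul_pow, pow_succ a]
    generalize 1 - q * q ^ n = d at hn ⊢
    field_simp
    ring

theorem Δw_eq {q : ℝ} {N s : ℕ} (hs : s ≤ N) {p : ℕ × ℕ}
    (hp : p ∈ antidiagonal s) (θ φ : ℝ) :
    Δw q N p.1 p.2 θ φ =
      (φ ^ (2 * N) * q ^ (-((N : ℤ) * (N + 1) / 2)) * qPoch q q N * (θ ^ 2 * q⁻¹) ^ s *
        ((-1 : ℝ) ^ (N - s) * qPoch q ((φ ^ 2)⁻¹ * q) (N - s) / qPoch q q (N - s))) *
      ((-1 : ℝ) ^ p.2 * q ^ (p.1 * (p.1 - 1) / 2) * qPoch q ((θ ^ 2)⁻¹ * q) p.2 /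
        (qPoch q q p.1 * qPoch q q p.2)) := by
  rw [HasAntidiagonal.mem_antidiagonal] at hp
  rw [Δw, qTrinom, hp, Nat.sub_sub, hp, show N - p.1 = (N - s) + p.2 by omega, pow_add]
  simp only [div_eq_mul_inv, mul_inv]
  ring

/-- Normalization of the bivariate quantum q-Krawtchouk weight:
the weight `Δ^{(N)}_{x₁,x₂}(θ,φ)` sums to one over the discrete simplex. -/
theorem weight_normalization (q : ℝ) (hq0 : 0 < q) (hq1 : q < 1)
    (N : ℕ) (hN : 0 < N) (θ φ : ℝ) (hθ : θ ≠ 0) (hφ : φ ≠ 0) :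
    ∑ x₁ ∈ Finset.range (N + 1), ∑ x₂ ∈ Finset.range (N + 1 - x₁),
      Δw q N x₁ x₂ θ φ = 1 := by
  have hne := qPoch_self_ne_zero hq0 hq1
  have hq : q ≠ 0 := hq0.ne'
  rw [← Finset.sum_range_diag_flip]
  have inner : ∀ s ∈ Finset.range (N + 1),
      ∑ k ∈ Finset.range (s + 1), Δw q N k (s - k) θ φ =
        φ ^ (2 * N) * q ^ (-((N : ℤ) * (N + 1) / 2)) * qPoch q q N *
          ((-1 : ℝ) ^ (N - s) * q ^ (s * (s - 1) / 2) * qPoch q ((φ ^ 2)⁻¹ * q) (N - s) /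
            (qPoch q q s * qPoch q q (N - s))) := by
    intro s hs
    have hs' : s ≤ N := Nat.lt_succ_iff.1 (Finset.mem_range.1 hs)
    rw [← Finset.Nat.sum_antidiagonal_eq_sum_range_succ (fun i j => Δw q N i j θ φ),
      Finset.sum_congr rfl fun p hp => Δw_eq hs' hp θ φ, ← Finset.mul_sum,
      sum_antidiagonal_qPoch hq0 hq1]
    have hcancel : (θ ^ 2 * q⁻¹) ^ s * ((θ ^ 2)⁻¹ * q) ^ s = 1 := by
      rw [← mul_pow, show θ ^ 2 * q⁻¹ * ((θ ^ 2)⁻¹ * q) = 1 by field_simp, one_pow]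
    simp only [div_eq_mul_inv, mul_inv]
    linear_combination (φ ^ (2 * N) * q ^ (-((N : ℤ) * (N + 1) / 2)) * qPoch q q N *
      ((-1 : ℝ) ^ (N - s) * q ^ (s * (s - 1) / 2) * qPoch q ((φ ^ 2)⁻¹ * q) (N - s) *
            ((qPoch q q s)⁻¹ * (qPoch q q (N - s))⁻¹))) * hcancel
  rw [Finset.sum_congr rfl inner, ← Finset.mul_sum,
    ← Finset.Nat.sum_antidiagonal_eq_sum_range_succ (fun i j =>
      (-1 : ℝ) ^ j * q ^ (i * (i - 1) / 2) * qPoch q ((φ ^ 2)⁻¹ * q) j /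
        (qPoch q q i * qPoch q q j)), sum_antidiagonal_qPoch hq0 hq1]
  have hexp : q ^ (-((N : ℤ) * (N + 1) / 2)) = (q ^ (N * (N - 1) / 2) * q ^ N)⁻¹ := by
    rw [← pow_add, ← succ_mul_self_div_two, zpow_neg, ← zpow_natCast]
    push_cast
    rw [mul_comm (N : ℤ)]
  have := hne N
  rw [hexp, mul_pow, pow_mul, inv_pow]
  field_simp
end

section
/- Lowering relation in the first degree index n₁: for every real q with 0 < q < 1, every positive integer N, all nonzero real numbers θ, φ, all integers n₁ ≥ 1 and n₂ ≥ 0 with n₁+n₂ ≤ N, and all integers x₁, x₂ ≥ 0 with x₁+x₂ ≤ N, one has (q^{n₁}(1-q^{n₁})/θ²) K_{n₁-1,n₂}(x₁,x₂; θ,φ; N) = q^{x₁+2} K_{n₁,n₂}(x₁,x₂+1; q^{1/2}θ, φ; N+1) - q^{x₁+2} K_{n₁,n₂}(x₁+1,x₂; q^{1/2}θ, φ; N+1). -/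
open Finset

/-- The backward difference of `(q^{-x};q)_{k+1}` in `x`. -/
theorem qPoch_zpow_neg_sub {q : ℝ} (hq : q ≠ 0) (x : ℤ) (k : ℕ) :
    qPoch q (q ^ (-x)) (k + 1) - qPoch q (q ^ (-(x + 1))) (k + 1) =
      q ^ (-(x + 1)) * (1 - q ^ (k + 1)) * qPoch q (q ^ (-x)) k := by
  have h : q ^ (-x) = q ^ (-(x + 1)) * q := by
    rw [← zpow_add_one₀ hq]
    congr 1
    ring
  rw [qPoch_succ, qPoch_succ', ← h, h]
  ring

/-- The forward shift relation of the quantum `q`-Krawtchouk polynomials. -/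
theorem qKraw_forward_shift {q : ℝ} (hq0 : 0 < q) (hq1 : q < 1) (m : ℕ) (x M : ℤ) (p : ℝ) :
    q ^ (m + 1) * (1 - q ^ (m + 1)) * p * qKraw q m x M p =
      q ^ (x + 2) *
        (qKraw q (m + 1) x (M + 1) (q⁻¹ * p) - qKraw q (m + 1) (x + 1) (M + 1) (q⁻¹ * p)) := by
  have hq : q ≠ 0 := hq0.ne'
  have htri : (m + 1) * (m + 1 - 1) / 2 = m * (m - 1) / 2 + m := by
    simpa [Finset.sum_range_id] using Finset.sum_range_succ (fun i : ℕ => i) m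
  have hn : q ^ (-((m + 1 : ℕ) : ℤ)) * q = q ^ (-(m : ℤ)) := by
    rw [← zpow_add_one₀ hq]
    congr 1
    push_cast
    ring
  have hn' : q ^ (-((m + 1 : ℕ) : ℤ)) = (q ^ (m + 1))⁻¹ := by
    rw [zpow_neg, zpow_natCast]
  have hx : q ^ (x + 2) = (q ^ (-(x + 1)))⁻¹ * q := by
    rw [zpow_neg, inv_inv, ← zpow_add_one₀ hq]
    congr 1
    ring
  unfold qKraw
  rw [← mul_sub, ← Finset.sum_sub_distrib, Finset.sum_range_succ' _ (m + 1), htri, hx]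
  have h0 : ∀ a : ℝ, qPoch q a 0 = 1 := fun a => Finset.prod_range_zero _
  simp only [h0, sub_self, add_zero, Finset.mul_sum]
  refine Finset.sum_congr rfl fun k _ => ?_
  have hM : ((k + 1 : ℕ) : ℤ) - (M + 1) = k - M := by
    push_cast
    ring
  have hk : 1 - q ^ (k + 1) ≠ 0 := sub_ne_zero.2 (pow_lt_one₀ hq0.le hq1 k.succ_ne_zero).ne'
  have hP : qPoch q q k ≠ 0 := qPoch_self_ne_zero hq0 hq1 k
  have hd := qPoch_zpow_neg_sub hq x k
  have hp : q⁻¹ * p * q ^ (m + 1 + 1) = p * q ^ (m + 1) := by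
    field_simp
    ring
  rw [hM, Nat.add_sub_add_right, hp, sub_eq_iff_eq_add.1 hd,
    qPoch_succ' q (q ^ (-((m + 1 : ℕ) : ℤ))), hn, hn', qPoch_succ q q k, ← pow_succ']
  field_simp
  ring

/-- Lowering relation in the first degree index `n₁`. -/
theorem lowering_n1 (q : ℝ) (hq0 : 0 < q) (hq1 : q < 1)
    (N : ℕ) (hN : 0 < N) (θ φ : ℝ) (hθ : θ ≠ 0) (hφ : φ ≠ 0)
    (n₁ n₂ : ℕ) (hn₁ : 1 ≤ n₁) (hn : n₁ + n₂ ≤ N) (x₁ x₂ : ℕ) (hx : x₁ + x₂ ≤ N) :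
    q ^ n₁ * (1 - q ^ n₁) / θ ^ 2 * Kq q ((n₁ : ℤ) - 1) n₂ x₁ x₂ θ φ N
    = q ^ (x₁ + 2) * Kq q n₁ n₂ x₁ ((x₂ : ℤ) + 1) (Real.sqrt q * θ) φ ((N : ℤ) + 1)
      - q ^ (x₁ + 2) * Kq q n₁ n₂ ((x₁ : ℤ) + 1) x₂ (Real.sqrt q * θ) φ ((N : ℤ) + 1) := by
  obtain ⟨m, rfl⟩ : ∃ m, n₁ = m + 1 := ⟨n₁ - 1, by omega⟩
  have hp : ((Real.sqrt q * θ) ^ 2)⁻¹ = q⁻¹ * (θ ^ 2)⁻¹ := by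
    rw [mul_pow, Real.sq_sqrt hq0.le, mul_inv]
  have h := qKraw_forward_shift hq0 hq1 m x₁ (x₁ + x₂) (θ ^ 2)⁻¹
  have hx2 : q ^ ((x₁ : ℤ) + 2) = q ^ (x₁ + 2) := by
    exact_mod_cast zpow_natCast q (x₁ + 2)
  rw [hx2] at h
  have e1 : ((m + 1 : ℕ) : ℤ) - 1 = m := by push_cast; ring
  have e2 : (x₁ : ℤ) + ((x₂ : ℤ) + 1) = x₁ + x₂ + 1 := by ring
  have e3 : (x₁ : ℤ) + 1 + x₂ = x₁ + x₂ + 1 := by ring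
  have e4 : (x₁ : ℤ) + x₂ + 1 - ((m + 1 : ℕ) : ℤ) = x₁ + x₂ - m := by push_cast; ring
  have e5 : (N : ℤ) + 1 - ((m + 1 : ℕ) : ℤ) = N - m := by push_cast; ring
  simp only [Kq, e1, e2, e3, e4, e5, hp, Nat.cast_nonneg, and_self, if_true, Int.toNat_natCast]
  rw [div_eq_mul_inv, ← mul_assoc, h]
  ring
end

section
/- Lowering relation in the second degree index n₂: for every real q with 0 < q < 1, every positive integer N, all nonzero real numbers θ, φ, all integers n₁ ≥ 0 and n₂ ≥ 1 with n₁+n₂ ≤ N, and all integers x₁, x₂ ≥ 0 with x₁+x₂ ≤ N, one has (q^{n₁+n₂}(1-q^{n₂})/φ²) K_{n₁,n₂-1}(x₁,x₂; θ, q^{-1/2}φ; N) = -θ² q^{x₁} K_{n₁,n₂}(x₁+1,x₂; θ,φ; N+1) + θ² q^{x₁}(1-θ^{-2}q^{x₂+1}) K_{n₁,n₂}(x₁,x₂+1; θ,φ; N+1) + q^{x₁+x₂+1} K_{n₁,n₂}(x₁,x₂; θ,φ; N+1). -/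
open Finset

theorem qPoch_zero (q a : ℝ) : qPoch q a 0 = 1 := by simp [qPoch]

theorem qPoch_succ_left (q a : ℝ) (n : ℕ) :
    qPoch q a (n + 1) = (1 - a) * qPoch q (q * a) n := by
  simp only [qPoch, Finset.prod_range_succ', pow_zero, mul_one]
  rw [mul_comm]
  congr 1
  exact Finset.prod_congr rfl fun k _ => by ring

/-- Backward difference of the q-Pochhammer symbol in its base. -/
theorem qPoch_succ_sub (q a : ℝ) (n : ℕ) :
    qPoch q a (n + 1) - qPoch q (q * a) (n + 1) =
      -(a * (1 - q ^ (n + 1))) * qPoch q (q * a) n := by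
  rw [qPoch_succ_left, qPoch_succ q (q * a)]
  ring

theorem qPoch_self_pos {q : ℝ} (hq0 : 0 < q) (hq1 : q < 1) (n : ℕ) : 0 < qPoch q q n := by
  refine Finset.prod_pos fun k _ => ?_
  have h : q ^ (k + 1) < 1 := pow_lt_one₀ hq0.le hq1 (by simp)
  rw [pow_succ'] at h
  linarith

/-- The sum defining `qKraw`, with `q ^ (-n)`, `q ^ (-x)`, `q ^ (-N)` replaced by `c`, `u`, `v`. -/
noncomputable def qKrawSum (q : ℝ) (n : ℕ) (c u v p : ℝ) : ℝ :=
  ∑ k ∈ Finset.range (n + 1),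
    qPoch q c k * qPoch q u k * qPoch q (q ^ k * v) (n - k) / qPoch q q k * (p * q ^ (n + 1)) ^ k

theorem qKraw_eq_qKrawSum {q : ℝ} (hq : q ≠ 0) (n : ℕ) (x N : ℤ) (p : ℝ) :
    qKraw q n x N p = (-1 : ℝ) ^ n * q ^ (n * (n - 1) / 2) *
      qKrawSum q n (q ^ (-(n : ℤ))) (q ^ (-x)) (q ^ (-N)) p := by
  simp only [qKraw, qKrawSum]
  congr 1
  refine Finset.sum_congr rfl fun k _ => ?_
  rw [sub_eq_add_neg (k : ℤ) N, zpow_add₀ hq, zpow_natCast]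

theorem qKrawSum_sub_left {q : ℝ} (hq0 : 0 < q) (hq1 : q < 1) (n : ℕ) (c t w p : ℝ) :
    qKrawSum q (n + 1) c t w p - qKrawSum q (n + 1) c (q * t) w p =
      ∑ k ∈ Finset.range (n + 1), qPoch q c (k + 1) * qPoch q (q * t) k *
        qPoch q (q ^ k * (q * w)) (n - k) / qPoch q q k * (p * q ^ (n + 2)) ^ (k + 1) * -t := by
  rw [qKrawSum, qKrawSum, ← Finset.sum_sub_distrib, Finset.sum_range_succ']
  simp only [qPoch_zero, sub_self, add_zero]
  refine Finset.sum_congr rfl fun k _ => ?_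
  have h1 := (qPoch_self_pos hq0 hq1 k).ne'
  have h2 : 1 - q ^ (k + 1) ≠ 0 := (sub_pos.2 (pow_lt_one₀ hq0.le hq1 (by simp))).ne'
  have h3 := qPoch_succ_sub q t k
  have h4 : qPoch q q (k + 1) = qPoch q q k * (1 - q ^ (k + 1)) := by rw [qPoch_succ]; ring
  rw [show n + 1 - (k + 1) = n - k by omega, show q ^ (k + 1) * w = q ^ k * (q * w) by ring,
    ← sub_mul, ← sub_div, ← sub_mul, ← mul_sub, h3, h4]
  field_simp

theorem qKrawSum_sub_right (q : ℝ) (n : ℕ) (c u w p : ℝ) :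
    qKrawSum q (n + 1) c u (q * w) p - qKrawSum q (n + 1) c u w p =
      ∑ k ∈ Finset.range (n + 1), qPoch q c k * qPoch q u k *
        qPoch q (q ^ k * (q * w)) (n - k) / qPoch q q k * (p * q ^ (n + 2)) ^ k *
          (w * (q ^ k - q ^ (n + 1))) := by
  rw [qKrawSum, qKrawSum, ← Finset.sum_sub_distrib, Finset.sum_range_succ]
  simp only [Nat.sub_self, qPoch_zero, sub_self, add_zero]
  refine Finset.sum_congr rfl fun k hk => ?_
  have hk : k ≤ n := by simpa [Nat.lt_succ_iff] using hk
  obtain ⟨m, rfl⟩ := Nat.exists_eq_add_of_le hk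
  have h3 := qPoch_succ_sub q (q ^ k * w) m
  rw [show k + m + 1 - k = m + 1 by omega, show k + m - k = m by omega,
    show q ^ k * (q * w) = q * (q ^ k * w) by ring,
    ← sub_mul, ← sub_div, ← mul_sub, ← neg_sub (qPoch q (q ^ k * w) (m + 1)), h3]
  ring

theorem qKrawSum_contiguous {q : ℝ} (hq0 : 0 < q) (hq1 : q < 1) (n : ℕ) (c t w p : ℝ)
    (hc : c * q ^ n = 1) :
    w * (qKrawSum q n c t w p - qKrawSum q n c (q * t) w p) =
      p * q * t * (qKrawSum q n c (q * t) (q * w) p - qKrawSum q n c (q * t) w p) := by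
  cases n with
  | zero => simp [qKrawSum, qPoch_zero]
  | succ n =>
    rw [qKrawSum_sub_left hq0 hq1, qKrawSum_sub_right, Finset.mul_sum, Finset.mul_sum]
    refine Finset.sum_congr rfl fun k _ => ?_
    rw [qPoch_succ q c]
    linear_combination (-(qPoch q c k * qPoch q (q * t) k *
        qPoch q (q ^ k * (q * w)) (n - k) / qPoch q q k * (p * q ^ (n + 2)) ^ k *
          (w * t * p * q * -q ^ k))) * hc

theorem qKrawSum_lowering {q : ℝ} (hq0 : 0 < q) (hq1 : q < 1) (n : ℕ) (c t w p : ℝ) :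
    qKrawSum q (n + 1) c t w p - qKrawSum q (n + 1) c (q * t) w p =
      -t * (1 - c) * (p * q ^ (n + 2)) * qKrawSum q n (q * c) (q * t) (q * w) (q * p) := by
  rw [qKrawSum_sub_left hq0 hq1, qKrawSum, Finset.mul_sum]
  refine Finset.sum_congr rfl fun k _ => ?_
  rw [qPoch_succ_left q c]
  ring

/-- Contiguous relation of `qKraw` in the variable and the size parameter. -/
theorem qKraw_contiguous {q : ℝ} (hq0 : 0 < q) (hq1 : q < 1) (n : ℕ) (x M : ℤ) (p : ℝ) :
    qKraw q n (x + 1) (M + 1) p - qKraw q n x (M + 1) p =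
      p * q ^ (M - x + 1) * (qKraw q n x M p - qKraw q n x (M + 1) p) := by
  have hq := hq0.ne'
  have h := qKrawSum_contiguous hq0 hq1 n (q ^ (-(n : ℤ))) (q ^ (-(x + 1))) (q ^ (-(M + 1))) p
    (by rw [← zpow_natCast q n, ← zpow_add₀ hq]; simp)
  rw [show q * q ^ (-(x + 1)) = q ^ (-x) by rw [← zpow_one_add₀ hq]; congr 1; ring,
    show q * q ^ (-(M + 1)) = q ^ (-M) by rw [← zpow_one_add₀ hq]; congr 1; ring] at h
  have e1 : q ^ (M + 1) * q ^ (-(M + 1)) = 1 := by rw [← zpow_add₀ hq]; simp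
  have e2 : q ^ (M + 1) * (q * q ^ (-(x + 1))) = q ^ (M - x + 1) := by
    rw [← zpow_one_add₀ hq, ← zpow_add₀ hq]; congr 1; ring
  simp only [qKraw_eq_qKrawSum hq]
  rw [← e2]
  set A := qKrawSum q n (q ^ (-(n : ℤ))) (q ^ (-(x + 1))) (q ^ (-(M + 1))) p
  set B := qKrawSum q n (q ^ (-(n : ℤ))) (q ^ (-x)) (q ^ (-(M + 1))) p
  set s := (-1 : ℝ) ^ n * q ^ (n * (n - 1) / 2)
  linear_combination s * q ^ (M + 1) * h - s * (A - B) * e1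

/-- Lowering relation of `qKraw` in its degree. -/
theorem qKraw_lowering {q : ℝ} (hq0 : 0 < q) (hq1 : q < 1) (n : ℕ) (x M : ℤ) (p : ℝ) :
    q ^ (n + 1) * (1 - q ^ (n + 1)) * p * qKraw q n x M (q * p) =
      q ^ (x + 1) * (qKraw q (n + 1) x (M + 1) p - qKraw q (n + 1) (x + 1) (M + 1) p) := by
  have hq := hq0.ne'
  have h := qKrawSum_lowering hq0 hq1 n (q ^ (-((n + 1 : ℕ) : ℤ))) (q ^ (-(x + 1)))
    (q ^ (-(M + 1))) p
  rw [show q * q ^ (-(x + 1)) = q ^ (-x) by rw [← zpow_one_add₀ hq]; congr 1; ring,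
    show q * q ^ (-(M + 1)) = q ^ (-M) by rw [← zpow_one_add₀ hq]; congr 1; ring,
    show q * q ^ (-((n + 1 : ℕ) : ℤ)) = q ^ (-(n : ℤ)) by
      rw [← zpow_one_add₀ hq]; congr 1; push_cast; ring] at h
  have e1 : q ^ (x + 1) * q ^ (-(x + 1)) = 1 := by rw [← zpow_add₀ hq]; simp
  have e2 : q ^ (-((n + 1 : ℕ) : ℤ)) * q ^ (n + 1) = 1 := by
    rw [← zpow_natCast q (n + 1), ← zpow_add₀ hq]; simp
  have e3 : q ^ ((n + 1) * (n + 1 - 1) / 2) = q ^ (n * (n - 1) / 2) * q ^ n := by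
    rw [← pow_add, ← Finset.sum_range_id_mul_two, ← Finset.sum_range_id_mul_two,
      Nat.mul_div_cancel _ two_pos, Nat.mul_div_cancel _ two_pos, Finset.sum_range_succ]
  simp only [qKraw_eq_qKrawSum hq]
  rw [e3, pow_succ (-1 : ℝ) n]
  set D := qKrawSum q n (q ^ (-(n : ℤ))) (q ^ (-x)) (q ^ (-M)) (q * p)
  set A := qKrawSum q (n + 1) (q ^ (-((n + 1 : ℕ) : ℤ))) (q ^ (-(x + 1))) (q ^ (-(M + 1))) p
  set B := qKrawSum q (n + 1) (q ^ (-((n + 1 : ℕ) : ℤ))) (q ^ (-x)) (q ^ (-(M + 1))) p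
  set s := (-1 : ℝ) ^ n * q ^ (n * (n - 1) / 2)
  set c := q ^ (-((n + 1 : ℕ) : ℤ))
  linear_combination -(s * q ^ n * q ^ (x + 1)) * h
    + s * q ^ n * (1 - c) * p * q ^ (n + 2) * D * e1
    - s * q ^ (n + 1) * p * D * e2

/-- Lowering relation in the second degree index `n₂`. -/
theorem lowering_n2 (q : ℝ) (hq0 : 0 < q) (hq1 : q < 1)
    (N : ℕ) (hN : 0 < N) (θ φ : ℝ) (hθ : θ ≠ 0) (hφ : φ ≠ 0)
    (n₁ n₂ : ℕ) (hn₂ : 1 ≤ n₂) (hn : n₁ + n₂ ≤ N) (x₁ x₂ : ℕ) (hx : x₁ + x₂ ≤ N) :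
    q ^ (n₁ + n₂) * (1 - q ^ n₂) / φ ^ 2 *
        Kq q n₁ ((n₂ : ℤ) - 1) x₁ x₂ θ (φ / Real.sqrt q) N
    = -(θ ^ 2) * q ^ x₁ * Kq q n₁ n₂ ((x₁ : ℤ) + 1) x₂ θ φ ((N : ℤ) + 1)
      + θ ^ 2 * q ^ x₁ * (1 - (θ ^ 2)⁻¹ * q ^ (x₂ + 1)) *
        Kq q n₁ n₂ x₁ ((x₂ : ℤ) + 1) θ φ ((N : ℤ) + 1)
      + q ^ (x₁ + x₂ + 1) * Kq q n₁ n₂ x₁ x₂ θ φ ((N : ℤ) + 1) := by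
  have hq := hq0.ne'
  obtain ⟨n, rfl⟩ : ∃ n, n₂ = n + 1 := ⟨n₂ - 1, by omega⟩
  have hp : ((φ / Real.sqrt q) ^ 2)⁻¹ = q * (φ ^ 2)⁻¹ := by
    rw [div_pow, Real.sq_sqrt hq0.le, inv_div, div_eq_mul_inv]
  have hA := qKraw_contiguous hq0 hq1 n₁ x₁ (x₁ + x₂) (θ ^ 2)⁻¹
  have hB := qKraw_lowering hq0 hq1 n (x₁ + x₂ - n₁) (N - n₁) (φ ^ 2)⁻¹
  have e1 : q ^ ((x₁ : ℤ) + x₂ - x₁ + 1) = q ^ (x₂ + 1) := by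
    rw [← zpow_natCast]; congr 1; push_cast; ring
  have e2 : q ^ n₁ * q ^ ((x₁ : ℤ) + x₂ - n₁ + 1) = q ^ (x₁ + x₂ + 1) := by
    rw [← zpow_natCast, ← zpow_natCast, ← zpow_add₀ hq]; congr 1; push_cast; ring
  have e3 : θ ^ 2 * (θ ^ 2)⁻¹ = 1 := mul_inv_cancel₀ (pow_ne_zero 2 hθ)
  rw [e1] at hA
  simp only [Kq, hp]
  rw [if_pos (by constructor <;> simp), if_pos (by constructor <;> positivity),
    if_pos (by constructor <;> positivity), if_pos (by constructor <;> positivity)]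
  rw [show ((n + 1 : ℕ) : ℤ) - 1 = n by push_cast; ring]
  simp only [Int.toNat_natCast]
  rw [show (x₁ : ℤ) + 1 + x₂ = x₁ + x₂ + 1 by ring, show (x₁ : ℤ) + (x₂ + 1) = x₁ + x₂ + 1 by ring,
    show (x₁ : ℤ) + x₂ + 1 - n₁ = x₁ + x₂ - n₁ + 1 by ring,
    show (N : ℤ) + 1 - n₁ = N - n₁ + 1 by ring]
  set a := qKraw q n₁ (x₁ + 1) (x₁ + x₂ + 1) (θ ^ 2)⁻¹
  set b := qKraw q n₁ x₁ (x₁ + x₂ + 1) (θ ^ 2)⁻¹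
  set d := qKraw q n₁ x₁ (x₁ + x₂) (θ ^ 2)⁻¹
  set e := qKraw q (n + 1) (x₁ + x₂ - n₁ + 1) (N - n₁ + 1) (φ ^ 2)⁻¹
  set f := qKraw q (n + 1) (x₁ + x₂ - n₁) (N - n₁ + 1) (φ ^ 2)⁻¹
  rw [div_eq_mul_inv]
  linear_combination q ^ n₁ * d * hB + d * (f - e) * e2 + θ ^ 2 * q ^ x₁ * e * hA
    + q ^ (x₁ + x₂ + 1) * d * e * e3
end
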